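/- arXiv:1702.00662 — 2 statements merged into one kernel-verified Lean document; each statement's English description precedes it below -/
import Mathlib

section
/- Let T ≥ 1 and let Φ₀ be the T×T tridiagonal matrix whose (1,1) entry is φ₀, whose other diagonal entries equal 2, whose entries on the first sub- and super-diagonals equal −1, and whose remaining entries are 0. Then det(σ₀² Φ₀) = σ₀^{2T} [1 + T(φ₀ − 1)]; in particular det(Φ₀) = 1 + T(φ₀ − 1), so Φ₀ has positive determinant if and only if φ₀ > 1 − 1/T. -/
open Matrix

/-- Expansion of a determinant whose first row and first column vanish beyond their first two
entries: the three-term recurrence for tridiagonal determinants. -/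
theorem Matrix.det_succ_succ_of_tridiagonal {R : Type*} [CommRing R] {n : ℕ}
    (A : Matrix (Fin (n + 2)) (Fin (n + 2)) R)
    (hrow : ∀ j : Fin n, A 0 j.succ.succ = 0) (hcol : ∀ i : Fin n, A i.succ.succ 0 = 0) :
    A.det = A 0 0 * (A.submatrix Fin.succ Fin.succ).det -
      A 0 1 * A 1 0 *
        (A.submatrix (fun i : Fin n => i.succ.succ) (fun j : Fin n => j.succ.succ)).det := by
  have minor : (A.submatrix Fin.succ (Fin.succAbove 1)).det =
      A 1 0 * (A.submatrix (fun i : Fin n => i.succ.succ) (fun j : Fin n => j.succ.succ)).det := by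
    rw [det_succ_column_zero, Fin.sum_univ_succ]
    simp [hcol, submatrix_submatrix, Function.comp_def]
  rw [det_succ_row_zero, Fin.sum_univ_succ, Fin.sum_univ_succ]
  simp [hrow, minor]
  ring

/-- The tridiagonal matrix with diagonal `(φ, 2, …, 2)` and off-diagonal entries `-1` has
determinant `1 + n (φ - 1)`. -/
theorem det_eq_of_tridiagonal_phi (n : ℕ) (φ : ℝ) (Φ : Matrix (Fin n) (Fin n) ℝ)
    (hΦ : ∀ s t : Fin n, Φ s t =
      if s = t then (if (s : ℕ) = 0 then φ else 2)
      else if (s : ℕ) + 1 = (t : ℕ) ∨ (t : ℕ) + 1 = (s : ℕ) then -1 else 0) :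
    Φ.det = 1 + (n : ℝ) * (φ - 1) := by
  induction n using Nat.twoStepInduction generalizing φ with
  | zero => simp
  | one => simp [det_unique, hΦ]
  | more n ih₁ ih₂ =>
    rw [det_succ_succ_of_tridiagonal Φ
      (fun j => by simp [hΦ, Fin.ext_iff]) (fun i => by simp [hΦ, Fin.ext_iff]),
      ih₁ 2 _ (fun s t => by simp only [submatrix_apply, hΦ, Fin.ext_iff, Fin.val_succ]; grind),
      ih₂ 2 _ (fun s t => by simp only [submatrix_apply, hΦ, Fin.ext_iff, Fin.val_succ]; grind)]
    simp [hΦ]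
    ring

/-- The determinant of the `T × T` tridiagonal matrix `Φ₀` arising as the error
variance-covariance structure of the first-differenced error-components panel model:
`det (σ₀² Φ₀) = σ₀^{2T} (1 + T (φ₀ − 1))`, `det Φ₀ = 1 + T (φ₀ − 1)`, and `Φ₀` has
positive determinant iff `φ₀ > 1 − 1/T`. -/
theorem det_tridiagonal_phi (T : ℕ) (hT : 1 ≤ T) (φ σsq : ℝ) (hσ : 0 < σsq)
    (Φ : Matrix (Fin T) (Fin T) ℝ)
    (hΦ : ∀ s t : Fin T, Φ s t =
      if s = t then (if (s : ℕ) = 0 then φ else 2)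
      else if (s : ℕ) + 1 = (t : ℕ) ∨ (t : ℕ) + 1 = (s : ℕ) then -1 else 0) :
    (σsq • Φ).det = σsq ^ T * (1 + (T : ℝ) * (φ - 1)) ∧
    Φ.det = 1 + (T : ℝ) * (φ - 1) ∧
    (0 < Φ.det ↔ 1 - 1 / (T : ℝ) < φ) := by
  have hdet := det_eq_of_tridiagonal_phi T φ Φ hΦ
  have hT' : (0 : ℝ) < T := by exact_mod_cast hT
  refine ⟨by rw [det_smul, Fintype.card_fin, hdet], hdet, ?_⟩
  rw [hdet, sub_lt_comm, lt_div_iff₀ hT']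
  constructor <;> intro h <;> linarith
end

section
/- In the differenced system, for each j = 1,…,p the identity (0, Δy_{i,−j}′) Υ₀^{−1} ũ_i = (β₀′, π₀′) Z̃_i′ D_j′ Υ₀^{−1} ũ_i + ũ_i′ D_j′ Υ₀^{−1} ũ_i holds, where D_j is the (T+p−1)×(T+p−1) block matrix with zero upper blocks and lower blocks (Ã_j I*, B̃_j), and D_j has zeros on its main diagonal. Consequently, if the elements of ũ_i are uncorrelated with the elements of Z̃_i and E(ũ_i ũ_i′) = Υ₀ with Υ₀ invertible, then E[(0, Δy_{i,−j}′) Υ₀^{−1} ũ_i] = 0 for j = 1,…,p. -/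
open MeasureTheory Matrix Finset

namespace DQML19

/-- The `p × p` companion matrix `F`. -/
def companion (p : ℕ) (δ : Fin p → ℝ) : Matrix (Fin p) (Fin p) ℝ :=
  Matrix.of fun r s =>
    if (r : ℕ) = 0 then δ s else if (s : ℕ) + 1 = (r : ℕ) then 1 else 0

/-- `fpow p δ t r s` is the `(r+1, s+1)` entry of `F^t`. -/
noncomputable def fpow (p : ℕ) (δ : Fin p → ℝ) (t r s : ℕ) : ℝ :=
  if hr : r < p then if hs : s < p then (companion p δ ^ t) ⟨r, hr⟩ ⟨s, hs⟩ else 0 else 0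

/-- The `T × p` matrix `A_j` of the levels companion representation. -/
noncomputable def Amat (p T : ℕ) (δ : Fin p → ℝ) (j : ℕ) : Matrix (Fin T) (Fin p) ℝ :=
  Matrix.of fun r s =>
    if (r : ℕ) + 1 ≤ j then (if (s : ℕ) + 1 = j - (r : ℕ) then 1 else 0)
    else fpow p δ ((r : ℕ) + 1 - j) 0 s

/-- The `T × T` matrix `B_j` of the levels companion representation. -/
noncomputable def Bmat (p T : ℕ) (δ : Fin p → ℝ) (j : ℕ) : Matrix (Fin T) (Fin T) ℝ :=
  Matrix.of fun r c =>
    if (r : ℕ) + 1 ≤ j then 0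
    else if (c : ℕ) + 1 = (r : ℕ) + 1 - j then 1
    else if (c : ℕ) + 1 < (r : ℕ) + 1 - j then fpow p δ ((r : ℕ) - j - (c : ℕ)) 0 0
    else 0

/-- `Ã_j`: the first `T − 1` rows of `A_j`. -/
noncomputable def Atil (p T : ℕ) (δ : Fin p → ℝ) (j : ℕ) :
    Matrix (Fin (T - 1)) (Fin p) ℝ :=
  Matrix.of fun r s => Amat p T δ j (Fin.castLE (Nat.sub_le T 1) r) s

/-- `B̃_j`: the leading `(T − 1) × (T − 1)` principal submatrix of `B_j`. -/
noncomputable def Btil (p T : ℕ) (δ : Fin p → ℝ) (j : ℕ) :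
    Matrix (Fin (T - 1)) (Fin (T - 1)) ℝ :=
  Matrix.of fun r c =>
    Bmat p T δ j (Fin.castLE (Nat.sub_le T 1) r) (Fin.castLE (Nat.sub_le T 1) c)

/-- The `p × p` anti-diagonal permutation matrix `I*`. -/
def Istar (p : ℕ) : Matrix (Fin p) (Fin p) ℝ :=
  Matrix.of fun r s => if (r : ℕ) + (s : ℕ) + 1 = p then 1 else 0

/-- The `(T + p − 1) × (T + p − 1)` block matrix `D_j` with zero upper blocks and
lower blocks `(Ã_j I*, B̃_j)`; it has zeros on its main diagonal. -/
noncomputable def Dmat (p T : ℕ) (δ : Fin p → ℝ) (j : ℕ) :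
    Matrix (Fin p ⊕ Fin (T - 1)) (Fin p ⊕ Fin (T - 1)) ℝ :=
  Matrix.fromBlocks 0 0 (Atil p T δ j * Istar p) (Btil p T δ j)

variable (T p K : ℕ)

/-- Index set for the vector `x_i` of distinct regressor elements. -/
abbrev XIdx := Fin T × Fin K

/-- Row index of the differenced system. -/
abbrev RIdx := Fin p ⊕ Fin (T - 1)

/-- Column index of `Z̃_i` (and the coefficient vector `(β₀′, π₀′)′`). -/
abbrev ZCIdx := Fin K ⊕ (Fin p × (Unit ⊕ XIdx T K))

/-- The vector `x_i` of distinct regressor elements. -/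
def xvec (x : ℤ → Fin K → ℝ) : XIdx T K → ℝ := fun a => x ((a.1 : ℤ) + 1) a.2

/-- The matrix `Z̃_i` with blocks `(0, I_p ⊗ (1, x_i′))` on top and `(ΔX_i, 0)` below. -/
def Ztil (x : ℤ → Fin K → ℝ) : Matrix (RIdx T p) (ZCIdx T p K) ℝ :=
  Matrix.of fun r c =>
    match r, c with
    | Sum.inl _, Sum.inl _ => 0
    | Sum.inl j, Sum.inr jc =>
        if j = jc.1 then Sum.elim (fun _ => (1 : ℝ)) (xvec T K x) jc.2 else 0
    | Sum.inr t, Sum.inl k => x ((t : ℤ) + 2) k - x ((t : ℤ) + 1) k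
    | Sum.inr _, Sum.inr _ => 0

/-- The error vector `ũ_i = (r_{i1}, …, r_{ip}, Δe_i′)′`, the first `p` components
being the linear-projection residuals of the initial differences on `(1, x_i′)`. -/
def util (y : ℤ → ℝ) (x : ℤ → Fin K → ℝ) (e : ℤ → ℝ)
    (μ0 : Fin p → ℝ) (θ0 : Fin p → XIdx T K → ℝ) : RIdx T p → ℝ :=
  Sum.elim
    (fun k : Fin p => (y ((k : ℤ) + 2 - (p : ℤ)) - y ((k : ℤ) + 1 - (p : ℤ)))
      - μ0 k - ∑ a, xvec T K x a * θ0 k a)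
    (fun t : Fin (T - 1) => e ((t : ℤ) + 2) - e ((t : ℤ) + 1))

end DQML19

open DQML19

namespace DQML19

/-- The companion recursion driven by shocks `ε`, solved forward from time `1`. -/
theorem companion_recursion_solution {p : ℕ} (hp : 0 < p) (δ : Fin p → ℝ) (d ε : ℤ → ℝ) (N : ℕ)
    (h : ∀ t : ℤ, 2 ≤ t → t ≤ N → d t = ∑ j : Fin p, δ j * d (t - ((j : ℤ) + 1)) + ε t)
    (m : ℕ) (hm : m + 1 ≤ N) :
    (fun s : Fin p => d (1 + m - s)) =
      companion p δ ^ m *ᵥ (fun s : Fin p => d (1 - s)) +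
        ∑ c ∈ range m, ε (c + 2) • (companion p δ ^ (m - 1 - c) *ᵥ Pi.single ⟨0, hp⟩ 1) := by
  induction m with
  | zero => simp
  | succ m ih =>
    have step : (fun s : Fin p => d (1 + (m + 1 : ℕ) - s)) =
        companion p δ *ᵥ (fun s : Fin p => d (1 + m - s)) +
          ε (m + 2) • Pi.single (⟨0, hp⟩ : Fin p) (1 : ℝ) := by
      ext s
      by_cases hs : (s : ℕ) = 0
      · have hs' : s = ⟨0, hp⟩ := Fin.ext hs
        subst hs'
        have := h (m + 2) (by omega) (by omega)
        simp only [companion, mulVec, dotProduct, of_apply, Pi.add_apply, Pi.smul_apply,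
          Pi.single_eq_same, smul_eq_mul, mul_one, if_true]
        convert this using 2
        · push_cast; ring_nf
        · exact sum_congr rfl fun i _ => by ring_nf
      · have hs' : s ≠ ⟨0, hp⟩ := fun h' => hs (congrArg Fin.val h')
        have hlt : (s : ℕ) - 1 < p := by omega
        simp only [companion, mulVec, dotProduct, of_apply, Pi.add_apply, Pi.smul_apply,
          Pi.single_eq_of_ne hs', smul_eq_mul, mul_zero, add_zero, if_neg hs]
        rw [sum_eq_single (⟨(s : ℕ) - 1, hlt⟩ : Fin p)]
        · rw [if_pos (by simp only []; omega), one_mul]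
          congr 1
          simp only []
          omega
        · intro b _ hb
          rw [if_neg, zero_mul]
          intro h'
          exact hb (Fin.ext (by simp only []; omega))
        · simp
    rw [step, ih (by omega), mulVec_add, mulVec_mulVec, ← pow_succ', sum_range_succ,
      mulVec_sum, add_assoc]
    congr 2
    · refine sum_congr rfl fun c hc => ?_
      have hc' := mem_range.mp hc
      rw [mulVec_smul, mulVec_mulVec, ← pow_succ',
        show m - 1 - c + 1 = m + 1 - 1 - c by omega]
    · rw [show m + 1 - 1 - m = 0 by omega, pow_zero, one_mulVec]

theorem Istar_mulVec (p : ℕ) (d : ℤ → ℝ) :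
    Istar p *ᵥ (fun k : Fin p => d ((k : ℤ) + 2 - p)) = fun s : Fin p => d (1 - s) := by
  ext s
  simp only [Istar, mulVec, dotProduct, of_apply]
  rw [sum_eq_single (⟨p - 1 - s, by omega⟩ : Fin p)]
  · rw [if_pos (by simp only []; omega), one_mul]
    congr 1
    simp only []
    omega
  · intro b _ hb
    rw [if_neg, zero_mul]
    intro h'
    exact hb (Fin.ext (by simp only []; omega))
  · simp

/-- `D_j` maps the initial differences and the differenced shocks to the lagged differences. -/
theorem Dmat_mulVec {p : ℕ} (T : ℕ) (hp : 0 < p) (δ : Fin p → ℝ) (d ε : ℤ → ℝ)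
    (h : ∀ t : ℤ, 2 ≤ t → t ≤ T → d t = ∑ j : Fin p, δ j * d (t - ((j : ℤ) + 1)) + ε t)
    (j : ℕ) (hj : 1 ≤ j) (hjp : j ≤ p) :
    Dmat p T δ j *ᵥ Sum.elim (fun k : Fin p => d ((k : ℤ) + 2 - p))
        (fun t : Fin (T - 1) => ε ((t : ℤ) + 2)) =
      Sum.elim (fun _ => 0) (fun r : Fin (T - 1) => d ((r : ℤ) + 2 - j)) := by
  rw [Dmat, fromBlocks_mulVec, Sum.elim_comp_inl, Sum.elim_comp_inr, ← mulVec_mulVec,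
    Istar_mulVec]
  ext r
  rcases r with r | r
  · simp
  · simp only [Sum.elim_inr, Pi.add_apply]
    have hr := r.isLt
    by_cases hrj : (r : ℕ) + 1 ≤ j
    · simp only [mulVec, dotProduct, Atil, Btil, Amat, Bmat, of_apply, Fin.val_castLE, if_pos hrj,
        zero_mul, sum_const_zero, add_zero]
      rw [sum_eq_single (⟨j - r - 1, by omega⟩ : Fin p)]
      · rw [if_pos (by simp only []; omega), one_mul]
        congr 1
        simp only []
        omega
      · intro b _ hb
        rw [if_neg, zero_mul]
        intro h'
        exact hb (Fin.ext (by simp only []; omega))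
      · simp
    · obtain ⟨m, hm⟩ : ∃ m : ℕ, (r : ℕ) + 1 = m + j := ⟨r + 1 - j, by omega⟩
      have sol := congrFun (companion_recursion_solution hp δ d ε T h m (by omega)) ⟨0, hp⟩
      have hidx : (r : ℤ) + 2 - j = 1 + m - ((⟨0, hp⟩ : Fin p) : ℕ) := by
        simp only []
        omega
      rw [hidx]
      refine Eq.symm (sol.trans ?_)
      have hrm : (r : ℕ) + 1 - j = m := by omega
      simp only [Pi.add_apply, Finset.sum_apply, Pi.smul_apply, mulVec_single_one, col_apply,
        smul_eq_mul]
      congr 1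
      · simp only [mulVec, dotProduct, Atil, Amat, of_apply, Fin.val_castLE, if_neg hrj, fpow, hrm,
          dif_pos hp, Fin.is_lt, dif_pos]
      · simp only [mulVec, dotProduct, Btil, Bmat, of_apply, Fin.val_castLE, if_neg hrj, hrm]
        rw [Fin.sum_univ_eq_sum_range (fun c : ℕ => (if c + 1 = m then (1 : ℝ) else
          if c + 1 < m then fpow p δ (r - j - c) 0 0 else 0) * ε (c + 2)) (T - 1)]
        have hsub : range m ⊆ range (T - 1) := range_subset_range.mpr (by omega)
        rw [← sum_subset hsub]
        · refine sum_congr rfl fun c hc => ?_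
          have hc' := mem_range.mp hc
          rw [mul_comm]
          congr 1
          by_cases hcm : c + 1 = m
          · rw [if_pos hcm, show m - 1 - c = 0 by omega]
            simp
          · rw [if_neg hcm, if_pos (by omega), show (r : ℕ) - j - c = m - 1 - c by omega]
            simp [fpow, hp]
        · intro c _ hc
          have hc' : ¬c < m := fun h' => hc (mem_range.mpr h')
          rw [if_neg (by omega), if_neg (by omega), zero_mul]

theorem Dmat_apply_self (p T : ℕ) (δ : Fin p → ℝ) {j : ℕ} (hj : 1 ≤ j)
    (r : Fin p ⊕ Fin (T - 1)) : Dmat p T δ j r r = 0 := by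
  rcases r with r | r
  · simp [Dmat]
  · simp only [Dmat, fromBlocks_apply₂₂, Btil, Bmat, of_apply, Fin.val_castLE]
    split_ifs <;> first | rfl | omega

theorem Ztil_mulVec_add_util (T p K : ℕ) (y : ℤ → ℝ) (x : ℤ → Fin K → ℝ) (e : ℤ → ℝ)
    (β : Fin K → ℝ) (μ0 : Fin p → ℝ) (θ0 : Fin p → XIdx T K → ℝ) :
    Ztil T p K x *ᵥ (Sum.elim β (fun jc => Sum.elim (fun _ => μ0 jc.1) (θ0 jc.1) jc.2)) +
        util T p K y x e μ0 θ0 =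
      Sum.elim (fun k : Fin p => y ((k : ℤ) + 2 - p) - y ((k : ℤ) + 1 - p))
        (fun t : Fin (T - 1) => ∑ k, (x ((t : ℤ) + 2) k - x ((t : ℤ) + 1) k) * β k +
          (e ((t : ℤ) + 2) - e ((t : ℤ) + 1))) := by
  ext r
  rcases r with r | r
  · simp only [Pi.add_apply, mulVec, dotProduct, Ztil, util, of_apply, Fintype.sum_sum_type,
      Fintype.sum_prod_type, Sum.elim_inl, Sum.elim_inr, zero_mul, sum_const_zero, zero_add,
      ite_mul]
    rw [sum_eq_single r (fun b _ hb => by simp [hb.symm]) (by simp)]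
    simp
  · simp [mulVec, dotProduct, Ztil, util]

/-- Expectation of a bilinear form in two random vectors with integrable products. -/
theorem integral_dotProduct_mulVec {α m n : Type*} [Fintype m] [Fintype n] [MeasurableSpace α]
    (μ : Measure α) (u : α → m → ℝ) (v : α → n → ℝ) (M : Matrix m n ℝ)
    (h : ∀ s t, Integrable (fun ω => u ω s * v ω t) μ) :
    Integrable (fun ω => u ω ⬝ᵥ M *ᵥ v ω) μ ∧
      ∫ ω, u ω ⬝ᵥ M *ᵥ v ω ∂μ = ∑ s, ∑ t, M s t * ∫ ω, u ω s * v ω t ∂μ := by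
  have key : (fun ω => u ω ⬝ᵥ M *ᵥ v ω) = fun ω => ∑ s, ∑ t, M s t * (u ω s * v ω t) := by
    ext ω
    simp only [dotProduct, mulVec, mul_sum]
    exact sum_congr rfl fun s _ => sum_congr rfl fun t _ => by ring
  have hi : ∀ s t, Integrable (fun ω => M s t * (u ω s * v ω t)) μ :=
    fun s t => (h s t).const_mul _
  rw [key]
  refine ⟨integrable_finsetSum _ fun s _ => integrable_finsetSum _ fun t _ => hi s t, ?_⟩
  rw [integral_finsetSum _ fun s _ => integrable_finsetSum _ fun t _ => hi s t]
  refine sum_congr rfl fun s _ => ?_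
  rw [integral_finsetSum _ fun t _ => hi s t]
  simp only [integral_const_mul]

end DQML19

/-- For each `j = 1, …, p`, the identity
`(0, Δy_{i,−j}′) Υ₀⁻¹ ũ_i = (β₀′, π₀′) Z̃_i′ D_j′ Υ₀⁻¹ ũ_i + ũ_i′ D_j′ Υ₀⁻¹ ũ_i` holds,
`D_j` has zeros on its main diagonal, and consequently, if the elements of `ũ_i` are
orthogonal in expectation to the elements of `Z̃_i` and `E(ũ_i ũ_i′) = Υ₀` is
invertible, then `E[(0, Δy_{i,−j}′) Υ₀⁻¹ ũ_i] = 0`. -/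
theorem diff_system_identity_and_orthogonality
    {α : Type*} [MeasurableSpace α] (μ : Measure α) [IsProbabilityMeasure μ]
    (T p K : ℕ) (hT : 1 ≤ T) (hp : 0 < p)
    (y : α → ℤ → ℝ) (x : α → ℤ → Fin K → ℝ) (e : α → ℤ → ℝ)
    (δ : Fin p → ℝ) (β : Fin K → ℝ)
    -- the dynamic panel data model
    (hmodel : ∀ ω (t : ℤ), 1 ≤ t → t ≤ (T : ℤ) →
      y ω t = (∑ j : Fin p, δ j * y ω (t - ((j : ℤ) + 1)))
        + (∑ k, x ω t k * β k) + e ω t)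
    -- linear projection coefficients `π₀ = (μ₀₁, θ₀₁′, …, μ₀p, θ₀p′)′`
    (μ0 : Fin p → ℝ) (θ0 : Fin p → XIdx T K → ℝ)
    -- integrability of second-order products
    (hint1 : ∀ (s : RIdx T p) (c : ZCIdx T p K) (t : RIdx T p),
      Integrable (fun ω => Ztil T p K (x ω) s c * util T p K (y ω) (x ω) (e ω) μ0 θ0 t) μ)
    (hint2 : ∀ s t : RIdx T p,
      Integrable (fun ω =>
        util T p K (y ω) (x ω) (e ω) μ0 θ0 s * util T p K (y ω) (x ω) (e ω) μ0 θ0 t) μ)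
    -- the elements of `ũ_i` are uncorrelated with the elements of `Z̃_i`
    (huncorr : ∀ (s : RIdx T p) (c : ZCIdx T p K) (t : RIdx T p),
      ∫ ω, Ztil T p K (x ω) s c * util T p K (y ω) (x ω) (e ω) μ0 θ0 t ∂μ = 0)
    -- `E(ũ_i ũ_i′) = Υ₀` with `Υ₀` invertible
    (Υ0 : Matrix (RIdx T p) (RIdx T p) ℝ) (hΥ0 : IsUnit Υ0.det)
    (hC3 : ∀ s t : RIdx T p,
      ∫ ω, util T p K (y ω) (x ω) (e ω) μ0 θ0 s *
        util T p K (y ω) (x ω) (e ω) μ0 θ0 t ∂μ = Υ0 s t) :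
    ∀ j : ℕ, 1 ≤ j → j ≤ p →
      -- the identity `(0, Δy_{i,−j}′) Υ₀⁻¹ ũ_i = (β₀′, π₀′) Z̃_i′ D_j′ Υ₀⁻¹ ũ_i
      --                + ũ_i′ D_j′ Υ₀⁻¹ ũ_i`
      (∀ ω,
        (Sum.elim (fun _ : Fin p => (0 : ℝ))
            (fun r : Fin (T - 1) => y ω ((r : ℤ) + 2 - (j : ℤ)) - y ω ((r : ℤ) + 1 - (j : ℤ))))
          ⬝ᵥ Υ0⁻¹ *ᵥ util T p K (y ω) (x ω) (e ω) μ0 θ0 =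
        (Sum.elim β (fun jc => Sum.elim (fun _ => μ0 jc.1) (θ0 jc.1) jc.2) : ZCIdx T p K → ℝ)
            ⬝ᵥ (Ztil T p K (x ω))ᵀ *ᵥ ((Dmat p T δ j)ᵀ *ᵥ
                (Υ0⁻¹ *ᵥ util T p K (y ω) (x ω) (e ω) μ0 θ0))
          + util T p K (y ω) (x ω) (e ω) μ0 θ0
            ⬝ᵥ (Dmat p T δ j)ᵀ *ᵥ (Υ0⁻¹ *ᵥ util T p K (y ω) (x ω) (e ω) μ0 θ0)) ∧
      -- `D_j` has zeros on its main diagonal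
      (∀ r : RIdx T p, Dmat p T δ j r r = 0) ∧
      -- consequently `E[(0, Δy_{i,−j}′) Υ₀⁻¹ ũ_i] = 0`
      ∫ ω,
        (Sum.elim (fun _ : Fin p => (0 : ℝ))
            (fun r : Fin (T - 1) => y ω ((r : ℤ) + 2 - (j : ℤ)) - y ω ((r : ℤ) + 1 - (j : ℤ))))
          ⬝ᵥ Υ0⁻¹ *ᵥ util T p K (y ω) (x ω) (e ω) μ0 θ0 ∂μ = 0 := by
  intro j hj hjp
  set coef : ZCIdx T p K → ℝ :=
    Sum.elim β (fun jc => Sum.elim (fun _ => μ0 jc.1) (θ0 jc.1) jc.2) with hcoef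
  have hD : ∀ ω, (Sum.elim (fun _ : Fin p => (0 : ℝ)) (fun r : Fin (T - 1) =>
      y ω ((r : ℤ) + 2 - (j : ℤ)) - y ω ((r : ℤ) + 1 - (j : ℤ)))) =
      Dmat p T δ j *ᵥ (Ztil T p K (x ω) *ᵥ coef + util T p K (y ω) (x ω) (e ω) μ0 θ0) := by
    intro ω
    rw [hcoef, Ztil_mulVec_add_util]
    have := Dmat_mulVec T hp δ (fun t => y ω t - y ω (t - 1))
      (fun t => ∑ k, (x ω t k - x ω (t - 1) k) * β k + (e ω t - e ω (t - 1)))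
      (fun t h2 hT' => by
        rw [hmodel ω t (by omega) hT', hmodel ω (t - 1) (by omega) (by omega)]
        simp only [mul_sub, sub_mul, sum_sub_distrib, sub_right_comm t 1]
        ring) j hj hjp
    have e1 : ∀ a : ℤ, a + 2 - 1 = a + 1 := fun a => by ring
    have e2 : ∀ a b : ℤ, a + 2 - b - 1 = a + 1 - b := fun a b => by ring
    simp only [e1, e2] at this
    exact this.symm
  have hid : ∀ ω, (Sum.elim (fun _ : Fin p => (0 : ℝ)) (fun r : Fin (T - 1) =>
      y ω ((r : ℤ) + 2 - (j : ℤ)) - y ω ((r : ℤ) + 1 - (j : ℤ))))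
        ⬝ᵥ Υ0⁻¹ *ᵥ util T p K (y ω) (x ω) (e ω) μ0 θ0 =
      coef ⬝ᵥ (Ztil T p K (x ω))ᵀ *ᵥ ((Dmat p T δ j)ᵀ *ᵥ
          (Υ0⁻¹ *ᵥ util T p K (y ω) (x ω) (e ω) μ0 θ0))
        + util T p K (y ω) (x ω) (e ω) μ0 θ0
          ⬝ᵥ (Dmat p T δ j)ᵀ *ᵥ (Υ0⁻¹ *ᵥ util T p K (y ω) (x ω) (e ω) μ0 θ0) := by
    intro ω
    rw [hD ω, dotProduct_mulVec coef, vecMul_transpose, ← add_dotProduct,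
      dotProduct_mulVec _ (Dmat p T δ j)ᵀ, vecMul_transpose]
  refine ⟨hid, Dmat_apply_self p T δ hj, ?_⟩
  have hZu : ∀ s t, Integrable (fun ω => (Ztil T p K (x ω) *ᵥ coef) s *
      util T p K (y ω) (x ω) (e ω) μ0 θ0 t) μ ∧ ∫ ω, (Ztil T p K (x ω) *ᵥ coef) s *
      util T p K (y ω) (x ω) (e ω) μ0 θ0 t ∂μ = 0 := by
    intro s t
    have key : (fun ω => (Ztil T p K (x ω) *ᵥ coef) s * util T p K (y ω) (x ω) (e ω) μ0 θ0 t) =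
        fun ω => ∑ c, coef c *
          (Ztil T p K (x ω) s c * util T p K (y ω) (x ω) (e ω) μ0 θ0 t) := by
      ext ω
      simp only [mulVec, dotProduct, sum_mul]
      exact sum_congr rfl fun c _ => by ring
    rw [key, integral_finsetSum _ fun c _ => (hint1 s c t).const_mul _]
    refine ⟨integrable_finsetSum _ fun c _ => (hint1 s c t).const_mul _, ?_⟩
    simp only [integral_const_mul, huncorr, mul_zero, sum_const_zero]
  have h1 := integral_dotProduct_mulVec μ (fun ω => Ztil T p K (x ω) *ᵥ coef)
    (fun ω => util T p K (y ω) (x ω) (e ω) μ0 θ0) ((Dmat p T δ j)ᵀ * Υ0⁻¹) fun s t => (hZu s t).1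
  have h2 := integral_dotProduct_mulVec μ (fun ω => util T p K (y ω) (x ω) (e ω) μ0 θ0)
    (fun ω => util T p K (y ω) (x ω) (e ω) μ0 θ0) ((Dmat p T δ j)ᵀ * Υ0⁻¹) hint2
  have hsymm : ∀ s t, Υ0 s t = Υ0 t s := fun s t => by
    rw [← hC3 s t, ← hC3 t s]
    simp only [mul_comm]
  have htrace : ∑ s, ∑ t, ((Dmat p T δ j)ᵀ * Υ0⁻¹) s t * Υ0 s t = 0 := by
    calc ∑ s, ∑ t, ((Dmat p T δ j)ᵀ * Υ0⁻¹) s t * Υ0 s t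
        = ((Dmat p T δ j)ᵀ * Υ0⁻¹ * Υ0).trace :=
          sum_congr rfl fun s _ => by
            rw [diag_apply, Matrix.mul_apply]
            exact sum_congr rfl fun t _ => by rw [hsymm s t]
      _ = 0 := by
          rw [Matrix.mul_assoc, nonsing_inv_mul _ hΥ0, Matrix.mul_one]
          exact sum_eq_zero fun s _ => Dmat_apply_self p T δ hj s
  have hid' : ∀ ω, _ = _ := fun ω => (hid ω).trans
    (by rw [dotProduct_mulVec coef, vecMul_transpose, mulVec_mulVec])
  simp only [hid']
  rw [integral_add h1.1 h2.1, h1.2, h2.2]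
  simp only [hZu, hC3, htrace, mul_zero, sum_const_zero, add_zero]
end
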